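/- Under the standing stochastic setup, let K ≥ 1, suppose the sampled Armijo condition holds almost surely at every iteration k ∈ {0, …, K−1} (f̃_k(x_{k+1}) + r(x_{k+1}) ≤ f̃_k(x_k) + r(x_k) − (α/t_k)‖x_k − x_{k+1}‖²), and suppose that almost surely the number of indices k ∈ {0, …, K−1} with t_k ≠ t_{k−1} (where t_{−1} ≜ s) is at most (J(K)+1)⌈[log_{1/β}(sL/(2(1−α)))]_+ + 2⌉ for a deterministic integer J(K) ≥ 0. Then (1/K) Σ_{k=0}^{K−1} E[‖G_s(x_k)‖²] ≤ 2(φ(x_0) − φ_inf)/(α c K) + ((1/L + 6 L s² + 2 α c)/(α c K)) Σ_{k=0}^{K−1} σ²/N_k + 6 L (s − c)² (L_r + 3 B_g)² (J(K)+1)⌈[log_{1/β}(sL/(2(1−α)))]_+ + 2⌉/(α c K), where [u]_+ ≜ max{u, 0}. -/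

import Mathlib

open MeasureTheory Filter
open scoped RealInnerProductSpace

section Deterministic

variable {E : Type*} [NormedAddCommGroup E] [InnerProductSpace ℝ E]

/-- `p` minimizes `y ↦ r y + ‖y - z‖ ^ 2 / (2 * t)` over `S`. -/
def IsProxPoint (S : Set E) (r : E → ℝ) (t : ℝ) (z p : E) : Prop :=
  p ∈ S ∧ ∀ y ∈ S, r p + ‖p - z‖ ^ 2 / (2 * t) ≤ r y + ‖y - z‖ ^ 2 / (2 * t)

variable {S : Set E} {r : E → ℝ}

lemma IsProxPoint.inner_le (hr : ConvexOn ℝ S r) {t : ℝ} (ht : 0 < t) {z p : E}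
    (hp : IsProxPoint S r t z p) {y : E} (hy : y ∈ S) :
    ⟪z - p, y - p⟫ ≤ t * (r y - r p) := by
  have key : ∀ l : ℝ, 0 < l → l ≤ 1 →
      ⟪z - p, y - p⟫ - t * (r y - r p) ≤ l * (‖y - p‖ ^ 2 / 2) := by
    intro l hl hl1
    have hmem := hr.1 hp.1 hy (sub_nonneg.2 hl1) hl.le (by ring)
    have h1 := hr.2 hp.1 hy (sub_nonneg.2 hl1) hl.le (by ring)
    have h2 := hp.2 _ hmem
    have h3 : (1 - l) • p + l • y - z = (p - z) + l • (y - p) := by module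
    have h4 : ⟪p - z, y - p⟫ = -⟪z - p, y - p⟫ := by rw [← inner_neg_left, neg_sub]
    rw [h3, norm_add_sq_real, inner_smul_right, norm_smul, mul_pow, h4, Real.norm_eq_abs,
      sq_abs] at h2
    simp only [smul_eq_mul] at h1
    have h5 : 0 ≤ l * (r y - r p)
        + (2 * (l * -⟪z - p, y - p⟫) + l ^ 2 * ‖y - p‖ ^ 2) / (2 * t) := by
      have e : (‖p - z‖ ^ 2 + 2 * (l * -⟪z - p, y - p⟫) + l ^ 2 * ‖y - p‖ ^ 2) / (2 * t)
        = ‖p - z‖ ^ 2 / (2 * t)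
          + (2 * (l * -⟪z - p, y - p⟫) + l ^ 2 * ‖y - p‖ ^ 2) / (2 * t) := by ring
      linarith
    have h6 : 0 ≤ l * (t * (r y - r p) - ⟪z - p, y - p⟫ + l * (‖y - p‖ ^ 2 / 2)) := by
      have := mul_nonneg ht.le h5
      field_simp at this ⊢
      linarith
    have := nonneg_of_mul_nonneg_right h6 hl
    linarith
  have hlim : Tendsto (fun l : ℝ => l * (‖y - p‖ ^ 2 / 2)) (nhdsWithin 0 (Set.Ioi 0)) (nhds 0) := by
    have : Continuous (fun l : ℝ => l * (‖y - p‖ ^ 2 / 2)) := by fun_prop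
    simpa using (this.tendsto 0).mono_left nhdsWithin_le_nhds
  have := ge_of_tendsto hlim (by
    filter_upwards [Ioo_mem_nhdsGT (zero_lt_one' ℝ)] with l hl using key l hl.1 hl.2.le)
  linarith

lemma IsProxPoint.mul_norm_sub_le (hr : ConvexOn ℝ S r) {t t' : ℝ} (ht : 0 < t) (ht' : 0 < t')
    {z z' p p' : E} (hp : IsProxPoint S r t z p) (hp' : IsProxPoint S r t' z' p') :
    t' * ‖p - p'‖ ≤ ‖t' • (z - z') + (t' - t) • (z' - p')‖ := by
  have h1 := mul_le_mul_of_nonneg_left (hp.inner_le hr ht hp'.1) ht'.le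
  have h2 := mul_le_mul_of_nonneg_left (hp'.inner_le hr ht' hp.1) ht.le
  have h3 : t' * ‖p - p'‖ ^ 2 ≤ ⟪t' • (z - z') + (t' - t) • (z' - p'), p - p'⟫ := by
    rw [← real_inner_self_eq_norm_sq]
    simp only [inner_add_left, inner_sub_left, inner_sub_right, inner_smul_left,
      RCLike.conj_to_real] at h1 h2 ⊢
    rw [real_inner_comm p p'] at *
    linarith
  have h4 := h3.trans (real_inner_le_norm _ _)
  rcases (norm_nonneg (p - p')).eq_or_lt with h | h
  · rw [← h]; simp
  · exact le_of_mul_le_mul_right (by linarith [sq ‖p - p'‖, mul_assoc t' ‖p - p'‖ ‖p - p'‖]) h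

lemma IsProxPoint.norm_sub_le (hr : ConvexOn ℝ S r) {t : ℝ} (ht : 0 < t)
    {z z' p p' : E} (hp : IsProxPoint S r t z p) (hp' : IsProxPoint S r t z' p') :
    ‖p - p'‖ ≤ ‖z - z'‖ := by
  have h := hp.mul_norm_sub_le hr ht ht hp'
  rw [sub_self, zero_smul, add_zero, norm_smul, Real.norm_of_nonneg ht.le] at h
  exact le_of_mul_le_mul_left h ht

lemma IsProxPoint.mul_norm_sub_le_of_step (hr : ConvexOn ℝ S r) {t t' : ℝ} (ht : 0 < t)
    (ht' : 0 < t') {x u p p' : E} (hp : IsProxPoint S r t (x - t • u) p)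
    (hp' : IsProxPoint S r t' (x - t' • u) p') :
    t' * ‖p - p'‖ ≤ |t' - t| * ‖x - p'‖ := by
  have h := hp.mul_norm_sub_le hr ht ht' hp'
  have e : t' • (x - t • u - (x - t' • u)) + (t' - t) • (x - t' • u - p')
      = (t' - t) • (x - p') := by module
  rwa [e, norm_smul, Real.norm_eq_abs] at h

lemma IsProxPoint.mul_norm_sub_le_mul_norm_sub (hr : ConvexOn ℝ S r) {t s : ℝ} (ht : 0 < t)
    (hts : t ≤ s) {x u p q : E} (hp : IsProxPoint S r t (x - t • u) p)
    (hq : IsProxPoint S r s (x - s • u) q) :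
    t * ‖x - q‖ ≤ s * ‖x - p‖ := by
  have hs := ht.trans_le hts
  have h := hp.mul_norm_sub_le_of_step hr ht hs hq
  rw [abs_of_nonneg (sub_nonneg.2 hts)] at h
  have := mul_le_mul_of_nonneg_left (norm_sub_le_norm_sub_add_norm_sub x p q) hs.le
  linarith

lemma IsProxPoint.norm_sub_le_mul (hr : ConvexOn ℝ S r) {Lr : ℝ}
    (hrlip : ∀ z ∈ S, ∀ w ∈ S, |r z - r w| ≤ Lr * ‖z - w‖) {t : ℝ} (ht : 0 < t)
    {x u p : E} (hx : x ∈ S) (hLu : 0 ≤ Lr + ‖u‖) (hp : IsProxPoint S r t (x - t • u) p) :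
    ‖x - p‖ ≤ t * (Lr + ‖u‖) := by
  have h1 := hp.inner_le hr ht hx
  have h2 := (le_abs_self _).trans (hrlip x hx p hp.1)
  have h3 := mul_le_mul_of_nonneg_left h2 ht.le
  have h4 := mul_le_mul_of_nonneg_left (real_inner_le_norm u (x - p)) ht.le
  have e : ⟪x - t • u - p, x - p⟫ = ‖x - p‖ ^ 2 - t * ⟪u, x - p⟫ := by
    rw [show x - t • u - p = (x - p) - t • u by abel, inner_sub_left,
      real_inner_self_eq_norm_sq, real_inner_smul_left]
  rcases (norm_nonneg (x - p)).eq_or_lt with h | h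
  · rw [← h]; positivity
  · refine le_of_mul_le_mul_right ?_ h
    nlinarith

/-- The descent lemma on a convex set. -/
lemma le_add_inner_add_of_gradient_lipschitzOn [CompleteSpace E] (hS : Convex ℝ S) {f : E → ℝ}
    {g : E → E} {L : ℝ} (hf : ∀ z ∈ S, HasGradientAt f (g z) z)
    (hg : ∀ z ∈ S, ∀ w ∈ S, ‖g z - g w‖ ≤ L * ‖z - w‖) {x y : E} (hx : x ∈ S) (hy : y ∈ S) :
    f y ≤ f x + ⟪g x, y - x⟫ + L / 2 * ‖y - x‖ ^ 2 := by
  set h : ℝ → ℝ := fun l => f (x + l • (y - x)) - l * ⟪g x, y - x⟫ - L / 2 * ‖y - x‖ ^ 2 * l ^ 2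
    with hh
  have hmem : ∀ l ∈ Set.Icc (0 : ℝ) 1, x + l • (y - x) ∈ S := fun l hl =>
    hS.add_smul_sub_mem hx hy hl
  have hder : ∀ l ∈ Set.Icc (0 : ℝ) 1, HasDerivAt h
      (⟪g (x + l • (y - x)), y - x⟫ - ⟪g x, y - x⟫ - L / 2 * ‖y - x‖ ^ 2 * (2 * l)) l := by
    intro l hl
    have h1 := (hf _ (hmem l hl)).hasFDerivAt
    have h2 : HasDerivAt (fun l : ℝ => x + l • (y - x)) (y - x) l := by
      simpa using ((hasDerivAt_id l).smul_const (y - x)).const_add x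
    have h3 := h1.comp_hasDerivAt l h2
    simp only [InnerProductSpace.toDual_apply_apply] at h3
    have h4 := ((hasDerivAt_id l).mul_const ⟪g x, y - x⟫)
    have h5 := (hasDerivAt_pow 2 l).const_mul (L / 2 * ‖y - x‖ ^ 2)
    refine ((h3.sub h4).sub h5).congr_deriv ?_
    simp
  have hanti : AntitoneOn h (Set.Icc 0 1) := by
    refine antitoneOn_of_deriv_nonpos (convex_Icc 0 1)
      (fun l hl => (hder l hl).continuousAt.continuousWithinAt)
      (fun l hl => (hder l (interior_subset hl)).differentiableAt.differentiableWithinAt) ?_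
    intro l hl
    have hl' := interior_subset hl
    rw [(hder l hl').deriv, ← inner_sub_left]
    have h1 := real_inner_le_norm (g (x + l • (y - x)) - g x) (y - x)
    have h2 := hg _ (hmem l hl') x hx
    rw [add_sub_cancel_left, norm_smul, Real.norm_of_nonneg hl'.1] at h2
    have h3 := mul_le_mul_of_nonneg_right h2 (norm_nonneg (y - x))
    nlinarith
  have := hanti (by simp) (by simp) (zero_le_one' ℝ)
  simp only [hh, one_smul, zero_smul, add_zero, add_sub_cancel] at this
  linarith

/-- Exchanging a sampled model `F` for `f` at a perturbed point. -/
lemma sub_le_sub_add_of_gradient_lipschitzOn [CompleteSpace E] (hS : Convex ℝ S)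
    {f F : E → ℝ} {g G : E → E} {L : ℝ} (hL : 0 < L) (hf : ∀ z ∈ S, HasGradientAt f (g z) z)
    (hg : ∀ z ∈ S, ∀ w ∈ S, ‖g z - g w‖ ≤ L * ‖z - w‖)
    (hF : ∀ z ∈ S, HasGradientAt F (G z) z)
    (hG : ∀ z ∈ S, ∀ w ∈ S, ‖G z - G w‖ ≤ L * ‖z - w‖) {x y : E} (hx : x ∈ S) (hy : y ∈ S) :
    f y - F y ≤ f x - F x + 1 / (2 * L) * ‖G x - g x‖ ^ 2 + 3 * L / 2 * ‖y - x‖ ^ 2 := by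
  have h1 := le_add_inner_add_of_gradient_lipschitzOn hS hf hg hx hy
  have h2 := le_add_inner_add_of_gradient_lipschitzOn (f := fun z => -F z) (g := fun z => -G z) hS
    (fun z hz => by
      have := (hF z hz).hasFDerivAt.neg
      rw [hasGradientAt_iff_hasFDerivAt, map_neg]
      exact this)
    (fun z hz w hw => by
      rw [show -G z - -G w = -(G z - G w) by abel, norm_neg]
      exact hG z hz w hw) hx hy
  have h3 : ⟪g x, y - x⟫ - ⟪G x, y - x⟫ ≤ ‖G x - g x‖ * ‖y - x‖ := by
    rw [← inner_sub_left, norm_sub_rev]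
    exact real_inner_le_norm _ _
  have h4 : ‖G x - g x‖ * ‖y - x‖ ≤ 1 / (2 * L) * ‖G x - g x‖ ^ 2 + L / 2 * ‖y - x‖ ^ 2 := by
    have : 0 ≤ 1 / (2 * L) * (‖G x - g x‖ - L * ‖y - x‖) ^ 2 := by positivity
    have e : 1 / (2 * L) * (‖G x - g x‖ - L * ‖y - x‖) ^ 2
      = 1 / (2 * L) * ‖G x - g x‖ ^ 2 + L / 2 * ‖y - x‖ ^ 2 - ‖G x - g x‖ * ‖y - x‖ := by
      field_simp
      ring
    linarith
  rw [inner_neg_left] at h2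
  linarith

lemma norm_sub_sq_le_of_step (hr : ConvexOn ℝ S r) {Lr : ℝ} (hLr : 0 ≤ Lr)
    (hrlip : ∀ z ∈ S, ∀ w ∈ S, |r z - r w| ≤ Lr * ‖z - w‖) {Bg c s t τ : ℝ}
    {x u v p p' q : E} (hx : x ∈ S) (hu : ‖u‖ ≤ Bg) (hc : 0 < c) (ht : c ≤ t ∧ t ≤ s)
    (hτ : c ≤ τ ∧ τ ≤ s) (hp : IsProxPoint S r t (x - t • v) p)
    (hp' : IsProxPoint S r t (x - t • u) p')
    (hq : IsProxPoint S r τ (x - τ • u) q) :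
    ‖p - q‖ ^ 2 ≤ 2 * s ^ 2 * ‖v - u‖ ^ 2
      + 2 * (s - c) ^ 2 * (Lr + 3 * Bg) ^ 2 * (if t ≠ τ then 1 else 0) := by
  have ht0 := hc.trans_le ht.1
  have hτ0 := hc.trans_le hτ.1
  have hB : 0 ≤ Bg := (norm_nonneg u).trans hu
  have h1 : ‖p - p'‖ ≤ s * ‖v - u‖ := by
    refine (hp.norm_sub_le hr ht0 hp').trans ?_
    rw [show x - t • v - (x - t • u) = -(t • (v - u)) by module, norm_neg, norm_smul,
      Real.norm_of_nonneg ht0.le]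
    gcongr
    exact ht.2
  have h2 : ‖p' - q‖ ≤ (s - c) * (Lr + 3 * Bg) * (if t ≠ τ then 1 else 0) := by
    have h3 := hp'.mul_norm_sub_le_of_step hr ht0 hτ0 hq
    have h4 := hq.norm_sub_le_mul hr hrlip hτ0 hx (by positivity)
    have h5 : ‖p' - q‖ ≤ |τ - t| * (Lr + ‖u‖) := by
      refine le_of_mul_le_mul_left ?_ hτ0
      nlinarith [mul_le_mul_of_nonneg_left h4 (abs_nonneg (τ - t))]
    split_ifs with h
    · rw [mul_one]
      refine h5.trans (mul_le_mul ?_ (by linarith) (by positivity) (by linarith))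
      rw [abs_le]
      constructor <;> linarith
    · have : t = τ := not_not.1 h
      simpa [this] using h5
  have h6 := norm_sub_le_norm_sub_add_norm_sub p p' q
  have hi : ((if t ≠ τ then 1 else 0 : ℝ)) ^ 2 = if t ≠ τ then 1 else 0 := by split_ifs <;> simp
  calc ‖p - q‖ ^ 2 ≤ (s * ‖v - u‖ + (s - c) * (Lr + 3 * Bg) * (if t ≠ τ then 1 else 0)) ^ 2 := by
        gcongr
        linarith
    _ ≤ 2 * ((s * ‖v - u‖) ^ 2 + ((s - c) * (Lr + 3 * Bg) * (if t ≠ τ then 1 else 0)) ^ 2) :=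
        add_sq_le
    _ = _ := by
        rw [mul_pow _ (if t ≠ τ then 1 else 0 : ℝ), hi]
        ring

/-- The step generated by the perturbed gradient `v` controls the exact gradient mapping. -/
lemma norm_gradientMapping_sq_le (hr : ConvexOn ℝ S r) {α c s t : ℝ} (hα : 0 < α) (hc : 0 < c)
    (ht : c ≤ t ∧ t ≤ s) {x u v p q q' : E} (hp : IsProxPoint S r t (x - t • v) p)
    (hq : IsProxPoint S r s (x - s • u) q) (hq' : IsProxPoint S r s (x - s • v) q') :
    α * c / 2 * ‖(1 / s) • (x - q)‖ ^ 2 ≤ α / t * ‖x - p‖ ^ 2 + α * c * ‖v - u‖ ^ 2 := by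
  have ht0 := hc.trans_le ht.1
  have hs0 := ht0.trans_le ht.2
  have h1 : ‖q' - q‖ ≤ s * ‖v - u‖ := by
    refine (hq'.norm_sub_le hr hs0 hq).trans_eq ?_
    rw [show x - s • v - (x - s • u) = -(s • (v - u)) by module, norm_neg, norm_smul,
      Real.norm_of_nonneg hs0.le]
  have h2 : ‖(1 / s) • (x - q)‖ ≤ ‖x - p‖ / t + ‖v - u‖ := by
    rw [norm_smul, Real.norm_of_nonneg (by positivity), one_div_mul_eq_div]
    have h3 : ‖x - q'‖ / s ≤ ‖x - p‖ / t := by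
      rw [div_le_div_iff₀ hs0 ht0]
      linarith [hp.mul_norm_sub_le_mul_norm_sub hr ht0 ht.2 hq']
    have h4 : ‖x - q‖ / s ≤ (‖x - q'‖ + s * ‖v - u‖) / s := by
      gcongr
      linarith [norm_sub_le_norm_sub_add_norm_sub x q' q]
    rw [add_div, mul_div_cancel_left₀ _ hs0.ne'] at h4
    linarith
  have h5 : ‖(1 / s) • (x - q)‖ ^ 2 ≤ 2 * ((‖x - p‖ / t) ^ 2 + ‖v - u‖ ^ 2) :=
    (pow_le_pow_left₀ (norm_nonneg _) h2 2).trans add_sq_le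
  have h6 : α * c * (‖x - p‖ / t) ^ 2 ≤ α / t * ‖x - p‖ ^ 2 := by
    calc α * c * (‖x - p‖ / t) ^ 2 ≤ α * t * (‖x - p‖ / t) ^ 2 := by gcongr; exact ht.1
      _ = _ := by field_simp
  have h7 := mul_le_mul_of_nonneg_left h5 (show 0 ≤ α * c / 2 by positivity)
  linarith

lemma continuous_prox_max (hr : ConvexOn ℝ S r) {prox : ℝ → E → E}
    (hprox : ∀ t, 0 < t → ∀ z, IsProxPoint S r t z (prox t z)) {c : ℝ} (hc : 0 < c) :
    Continuous fun q : ℝ × E => prox (max q.1 c) q.2 := by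
  have hpos : ∀ a : ℝ, 0 < max a c := fun a => hc.trans_le (le_max_right _ _)
  refine continuous_iff_continuousAt.2 fun q₀ => ?_
  rw [ContinuousAt, tendsto_iff_norm_sub_tendsto_zero]
  set t' := max q₀.1 c with ht'
  have hbound : ∀ q : ℝ × E, ‖prox (max q.1 c) q.2 - prox t' q₀.2‖
      ≤ ‖t' • (q.2 - q₀.2) + (t' - max q.1 c) • (q₀.2 - prox t' q₀.2)‖ / t' := by
    intro q
    rw [le_div_iff₀' (hpos _)]
    exact (hprox _ (hpos q.1) q.2).mul_norm_sub_le hr (hpos _) (hpos _) (hprox _ (hpos q₀.1) q₀.2)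
  refine squeeze_zero (fun _ => norm_nonneg _) hbound ?_
  have hcont : Continuous fun q : ℝ × E =>
      ‖t' • (q.2 - q₀.2) + (t' - max q.1 c) • (q₀.2 - prox t' q₀.2)‖ / t' := by fun_prop
  simpa [← ht'] using hcont.tendsto q₀

end Deterministic

section Conditional

variable {Ω : Type*} {m m0 : MeasurableSpace Ω} {μ : Measure Ω}

lemma integrable_and_integral_sub_eq_zero_of_condExp [IsFiniteMeasure μ] (hm : m ≤ m0)
    {X Y : Ω → ℝ} (hX : Integrable X μ) (h : μ[X|m] =ᵐ[μ] Y) :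
    Integrable (fun ω => X ω - Y ω) μ ∧ ∫ ω, (X ω - Y ω) ∂μ = 0 := by
  have hY : Integrable Y μ := integrable_condExp.congr h
  refine ⟨hX.sub hY, ?_⟩
  rw [integral_sub hX hY, ← integral_congr_ae h, integral_condExp hm, sub_self]

lemma integral_le_of_condExp_le [IsProbabilityMeasure μ] (hm : m ≤ m0) {X : Ω → ℝ} {b : ℝ}
    (h : ∀ᵐ ω ∂μ, (μ[X|m]) ω ≤ b) : ∫ ω, X ω ∂μ ≤ b := by
  rw [← integral_condExp hm]
  calc ∫ ω, (μ[X|m]) ω ∂μ ≤ ∫ _, b ∂μ := integral_mono_ae integrable_condExp (by simp) h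
    _ = b := by simp

end Conditional

theorem stmt10 {n : ℕ} {Ω : Type*} {m0 : MeasurableSpace Ω} {μ : Measure Ω}
    [IsProbabilityMeasure μ] (ℱ : Filtration ℕ m0)
    (S : Set (EuclideanSpace ℝ (Fin n))) (hSne : S.Nonempty) (hSclosed : IsClosed S)
    (r : EuclideanSpace ℝ (Fin n) → ℝ) (hrconv : ConvexOn ℝ S r)
    (Lr : ℝ) (hLr : 0 ≤ Lr)
    (hrlip : ∀ z ∈ S, ∀ w ∈ S, |r z - r w| ≤ Lr * ‖z - w‖)
    (prox : ℝ → EuclideanSpace ℝ (Fin n) → EuclideanSpace ℝ (Fin n))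
    (hprox_mem : ∀ t : ℝ, 0 < t → ∀ z, prox t z ∈ S)
    (hprox_min : ∀ t : ℝ, 0 < t → ∀ z, ∀ y ∈ S,
      r (prox t z) + ‖prox t z - z‖ ^ 2 / (2 * t) ≤ r y + ‖y - z‖ ^ 2 / (2 * t))
    (hprox_uniq : ∀ t : ℝ, 0 < t → ∀ z, ∀ y ∈ S,
      (∀ y' ∈ S, r y + ‖y - z‖ ^ 2 / (2 * t) ≤ r y' + ‖y' - z‖ ^ 2 / (2 * t)) → y = prox t z)
    (f : EuclideanSpace ℝ (Fin n) → ℝ) (g : EuclideanSpace ℝ (Fin n) → EuclideanSpace ℝ (Fin n))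
    (U : Set (EuclideanSpace ℝ (Fin n))) (hU : IsOpen U) (hSU : S ⊆ U)
    (hf : ∀ z ∈ U, HasGradientAt f (g z) z)
    (L : ℝ) (hL : 0 < L)
    (hglip : ∀ z ∈ S, ∀ w ∈ S, ‖g z - g w‖ ≤ L * ‖z - w‖)
    (Bg : ℝ) (hBg : ∀ z ∈ S, ‖g z‖ ≤ Bg)
    (φinf : ℝ) (hφinf : ∀ z ∈ S, φinf ≤ f z + r z)
    (α β s : ℝ) (hα : α ∈ Set.Ioo (0:ℝ) 1) (hβ : β ∈ Set.Ioo (0:ℝ) 1) (hs : 0 < s)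
    (c : ℝ) (hc : c = min s (2 * (1 - α) * β / L))
    (σ : ℝ) (hσ : 0 < σ)
    (N : ℕ → ℕ) (hN : ∀ k, 0 < N k)
    (x : ℕ → Ω → EuclideanSpace ℝ (Fin n)) (t : ℕ → Ω → ℝ)
    (x₀ : EuclideanSpace ℝ (Fin n)) (hx₀ : x₀ ∈ S) (hx₀det : ∀ ω, x 0 ω = x₀)
    (hxmeas : ∀ k, StronglyMeasurable[ℱ k] (x k))
    (htmeas : ∀ k, StronglyMeasurable[ℱ (k + 1)] (t k))
    (htbd : ∀ k, ∀ᵐ ω ∂μ, c ≤ t k ω ∧ t k ω ≤ s)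
    (F : ℕ → Ω → EuclideanSpace ℝ (Fin n) → ℝ) (GF : ℕ → Ω → EuclideanSpace ℝ (Fin n) → EuclideanSpace ℝ (Fin n))
    (hFgrad : ∀ k, ∀ᵐ ω ∂μ, (∀ z ∈ U, HasGradientAt (F k ω) (GF k ω z) z) ∧
      ∀ z ∈ S, ∀ w ∈ S, ‖GF k ω z - GF k ω w‖ ≤ L * ‖z - w‖)
    (horacle_f : ∀ k, ∀ y : Ω → EuclideanSpace ℝ (Fin n),
      StronglyMeasurable[ℱ k] y → (∀ ω, y ω ∈ S) →
      Integrable (fun ω => F k ω (y ω)) μ ∧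
        μ[(fun ω => F k ω (y ω))|ℱ k] =ᵐ[μ] fun ω => f (y ω))
    (horacle_g : ∀ k, ∀ y : Ω → EuclideanSpace ℝ (Fin n),
      StronglyMeasurable[ℱ k] y → (∀ ω, y ω ∈ S) →
      Integrable (fun ω => GF k ω (y ω)) μ ∧
        μ[(fun ω => GF k ω (y ω))|ℱ k] =ᵐ[μ] fun ω => g (y ω))
    (horacle_var : ∀ k, ∀ y : Ω → EuclideanSpace ℝ (Fin n),
      StronglyMeasurable[ℱ k] y → (∀ ω, y ω ∈ S) →
      Integrable (fun ω => ‖GF k ω (y ω) - g (y ω)‖ ^ 2) μ ∧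
        ∀ᵐ ω ∂μ, (μ[(fun ω' => ‖GF k ω' (y ω') - g (y ω')‖ ^ 2)|ℱ k]) ω ≤ σ ^ 2 / N k)
    (hupdate : ∀ k, ∀ᵐ ω ∂μ,
      x (k + 1) ω = prox (t k ω) (x k ω - t k ω • GF k ω (x k ω)))
    (K : ℕ) (hK : 1 ≤ K)
    (harmijo : ∀ k, k < K → ∀ᵐ ω ∂μ, F k ω (x (k + 1) ω) + r (x (k + 1) ω)
        ≤ F k ω (x k ω) + r (x k ω) - (α / t k ω) * ‖x k ω - x (k + 1) ω‖ ^ 2)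
    (hφint : ∀ k, k ≤ K → Integrable (fun ω => f (x k ω) + r (x k ω)) μ)
    (hGint : ∀ k, k < K → Integrable (fun ω => ‖(1 / s) • (x k ω - prox s (x k ω - s • g (x k ω)))‖ ^ 2) μ)
    (hFint : ∀ k, k < K → Integrable (fun ω => F k ω (x (k + 1) ω) + r (x (k + 1) ω)) μ)
    (J : ℕ)
    (hchange : ∀ᵐ ω ∂μ,
      (((Finset.range K).filter (fun i => t i ω ≠ if i = 0 then s else t (i - 1) ω)).card : ℝ) ≤ ((J : ℝ) + 1) * ((⌈max (Real.logb (1 / β) (s * L / (2 * (1 - α)))) 0 + 2⌉ : ℤ) : ℝ)) :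
    (1 / K) * ∑ k ∈ Finset.range K, ∫ ω, ‖(1 / s) • (x k ω - prox s (x k ω - s • g (x k ω)))‖ ^ 2 ∂μ
      ≤ 2 * (f x₀ + r x₀ - φinf) / (α * c * K)
        + ((1 / L + 6 * L * s ^ 2 + 2 * α * c) / (α * c * K))
          * ∑ k ∈ Finset.range K, σ ^ 2 / N k
        + 6 * L * (s - c) ^ 2 * (Lr + 3 * Bg) ^ 2 * ((J : ℝ) + 1) * ((⌈max (Real.logb (1 / β) (s * L / (2 * (1 - α)))) 0 + 2⌉ : ℤ) : ℝ)
          / (α * c * K) := by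
  have hc0 : 0 < c := by
    rw [hc]
    have := sub_pos.2 hα.2
    have := hβ.1
    exact lt_min hs (by positivity)
  have hcs : c ≤ s := hc ▸ min_le_left _ _
  have hα0 : 0 < α := hα.1
  have hBg0 : 0 ≤ Bg := (norm_nonneg _).trans (hBg x₀ hx₀)
  have hprox : ∀ t, 0 < t → ∀ z, IsProxPoint S r t z (prox t z) := fun t ht z =>
    ⟨hprox_mem t ht z, hprox_min t ht z⟩
  have hxS : ∀ k, ∀ᵐ ω ∂μ, x k ω ∈ S := by
    intro k
    cases k with
    | zero => exact .of_forall fun ω => hx₀det ω ▸ hx₀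
    | succ k =>
      filter_upwards [hupdate k, htbd k] with ω h1 h2
      rw [h1]
      exact hprox_mem _ (hc0.trans_le h2.1) _
  classical
  -- A modification of `x` that lies in `S` everywhere.
  set y : ℕ → Ω → EuclideanSpace ℝ (Fin n) := fun k ω => if x k ω ∈ S then x k ω else x₀ with hy
  have hyS : ∀ k ω, y k ω ∈ S := by
    intro k ω
    by_cases h : x k ω ∈ S <;> simp [hy, h, hx₀]
  have hymeas : ∀ k, StronglyMeasurable[ℱ k] (y k) := fun k =>
    StronglyMeasurable.ite ((hxmeas k).measurable hSclosed.measurableSet) (hxmeas k)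
      stronglyMeasurable_const
  have hyx : ∀ k, ∀ᵐ ω ∂μ, y k ω = x k ω := by
    intro k
    filter_upwards [hxS k] with ω h using if_pos h
  have hgcont : ContinuousOn g S :=
    (LipschitzOnWith.of_dist_le_mul (K := ⟨L, hL.le⟩) fun z hz w hw => by
      rw [dist_eq_norm, dist_eq_norm]
      exact hglip z hz w hw).continuousOn
  have hgmeas : Measurable (S.piecewise g 0) :=
    hgcont.measurable_piecewise continuousOn_const hSclosed.measurableSet
  have hgy : ∀ k, StronglyMeasurable[ℱ k] fun ω => g (y k ω) := by
    intro k
    have h : (fun ω => g (y k ω)) = S.piecewise g 0 ∘ y k := by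
      ext1 ω
      exact (Set.piecewise_eq_of_mem _ _ _ (hyS k ω)).symm
    rw [h]
    exact (hgmeas.comp (hymeas k).measurable).stronglyMeasurable
  -- The previous step size, and the deterministic-gradient step taken with it.
  set τ : ℕ → Ω → ℝ := fun k ω => if k = 0 then s else t (k - 1) ω with hτ
  have hτmeas : ∀ k, StronglyMeasurable[ℱ k] (τ k) := by
    intro k
    cases k with
    | zero => simpa [hτ] using stronglyMeasurable_const
    | succ k => simpa [hτ] using htmeas k
  have hτbd : ∀ k, ∀ᵐ ω ∂μ, c ≤ τ k ω ∧ τ k ω ≤ s := by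
    intro k
    cases k with
    | zero => simp [hτ, hcs]
    | succ k => simpa [hτ] using htbd k
  set w : ℕ → Ω → EuclideanSpace ℝ (Fin n) := fun k ω =>
    prox (max (τ k ω) c) (y k ω - max (τ k ω) c • g (y k ω)) with hw
  have hwS : ∀ k ω, w k ω ∈ S := fun k ω => hprox_mem _ (hc0.trans_le (le_max_right _ _)) _
  have hwmeas : ∀ k, StronglyMeasurable[ℱ k] (w k) := by
    intro k
    have hm : StronglyMeasurable[ℱ k] fun ω => max (τ k ω) c :=
      (continuous_id.max continuous_const).comp_stronglyMeasurable (hτmeas k)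
    exact (continuous_prox_max hrconv hprox hc0).comp_stronglyMeasurable
      ((hτmeas k).prodMk ((hymeas k).sub (hm.smul (hgy k))))
  set D : ℕ → Ω → ℝ := fun k ω => if t k ω ≠ τ k ω then 1 else 0 with hD
  have hDint : ∀ k, Integrable (D k) μ := by
    intro k
    have hset : MeasurableSet {ω | t k ω ≠ τ k ω} :=
      (measurableSet_eq_fun ((htmeas k).mono (ℱ.le _)).measurable
        ((hτmeas k).mono (ℱ.le _)).measurable).compl
    refine Integrable.of_bound
      (Measurable.ite hset measurable_const measurable_const).aestronglyMeasurable 1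
      (.of_forall fun ω => ?_)
    by_cases h : t k ω = τ k ω <;> simp [hD, h]
  have hstep : ∀ k < K, α * c / 2 *
        ∫ ω, ‖(1 / s) • (x k ω - prox s (x k ω - s • g (x k ω)))‖ ^ 2 ∂μ
      ≤ ∫ ω, (f (x k ω) + r (x k ω)) ∂μ - ∫ ω, (f (x (k + 1) ω) + r (x (k + 1) ω)) ∂μ
        + (1 / (2 * L) + 3 * L * s ^ 2 + α * c) * (σ ^ 2 / N k)
        + 3 * L * (s - c) ^ 2 * (Lr + 3 * Bg) ^ 2 * ∫ ω, D k ω ∂μ := by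
    intro k hk
    obtain ⟨ix, zx⟩ := integrable_and_integral_sub_eq_zero_of_condExp (ℱ.le k)
      (horacle_f k _ (hymeas k) (hyS k)).1 (horacle_f k _ (hymeas k) (hyS k)).2
    obtain ⟨iw, zw⟩ := integrable_and_integral_sub_eq_zero_of_condExp (ℱ.le k)
      (horacle_f k _ (hwmeas k) (hwS k)).1 (horacle_f k _ (hwmeas k) (hwS k)).2
    obtain ⟨ivx, vx⟩ := horacle_var k _ (hymeas k) (hyS k)
    obtain ⟨ivw, vw⟩ := horacle_var k _ (hwmeas k) (hwS k)
    replace vx := integral_le_of_condExp_le (ℱ.le k) vx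
    replace vw := integral_le_of_condExp_le (ℱ.le k) vw
    have hae : ∀ᵐ ω ∂μ, α * c / 2 * ‖(1 / s) • (x k ω - prox s (x k ω - s • g (x k ω)))‖ ^ 2
        ≤ (f (x k ω) + r (x k ω)) - (f (x (k + 1) ω) + r (x (k + 1) ω))
          + (F k ω (y k ω) - f (y k ω)) - (F k ω (w k ω) - f (w k ω))
          + 1 / (2 * L) * ‖GF k ω (w k ω) - g (w k ω)‖ ^ 2
          + (3 * L * s ^ 2 + α * c) * ‖GF k ω (y k ω) - g (y k ω)‖ ^ 2
          + 3 * L * (s - c) ^ 2 * (Lr + 3 * Bg) ^ 2 * D k ω := by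
      filter_upwards [hyx k, hxS k, hxS (k + 1), htbd k, hτbd k, hFgrad k, hupdate k,
        harmijo k hk] with ω hyω hxω hxω' htω hτω hFω hupω harω
      have ht0 := hc0.trans_le htω.1
      have hτ0 := hc0.trans_le hτω.1
      have hp := hprox _ ht0 (x k ω - t k ω • GF k ω (x k ω))
      rw [← hupω] at hp
      have hq : IsProxPoint S r (τ k ω) (x k ω - τ k ω • g (x k ω)) (w k ω) := by
        have := hprox _ hτ0 (x k ω - τ k ω • g (x k ω))
        simpa [hw, hyω, max_eq_left hτω.1] using this
      have h1 := sub_le_sub_add_of_gradient_lipschitzOn hrconv.1 hL (fun z hz => hf z (hSU hz))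
        hglip (fun z hz => hFω.1 z (hSU hz)) hFω.2 (hwS k ω) hxω'
      have h2 := norm_sub_sq_le_of_step hrconv hLr hrlip hxω (hBg _ hxω) hc0 htω hτω hp
        (hprox _ ht0 (x k ω - t k ω • g (x k ω))) hq
      have h3 := norm_gradientMapping_sq_le hrconv hα0 hc0 htω hp
        (hprox s hs (x k ω - s • g (x k ω))) (hprox s hs (x k ω - s • GF k ω (x k ω)))
      have h4 := mul_le_mul_of_nonneg_left h2 (show 0 ≤ 3 * L / 2 by positivity)
      rw [hyω]
      simp only [hD]
      linarith
    have iφ := hφint k hk.le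
    have iφ' := hφint (k + 1) hk
    have i1 := iφ.sub iφ'
    have i2 := i1.add ix
    have i3 := i2.sub iw
    have i4 := i3.add (ivw.const_mul (1 / (2 * L)))
    have i5 := i4.add (ivx.const_mul (3 * L * s ^ 2 + α * c))
    have i6 := (hDint k).const_mul (3 * L * (s - c) ^ 2 * (Lr + 3 * Bg) ^ 2)
    have hint := integral_mono_ae ((hGint k hk).const_mul (α * c / 2)) (i5.add i6) hae
    rw [integral_add' i5 i6, integral_add' i4 (ivx.const_mul _),
      integral_add' i3 (ivw.const_mul _), integral_sub' i2 iw, integral_add' i1 ix,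
      integral_sub' iφ iφ', zx, zw] at hint
    simp only [integral_const_mul] at hint
    have h1 := mul_le_mul_of_nonneg_left vw (show 0 ≤ 1 / (2 * L) by positivity)
    have h2 := mul_le_mul_of_nonneg_left vx (show 0 ≤ 3 * L * s ^ 2 + α * c by positivity)
    linarith
  set C : ℝ := ((⌈max (Real.logb (1 / β) (s * L / (2 * (1 - α)))) 0 + 2⌉ : ℤ) : ℝ) with hC
  have hDsum : ∑ k ∈ Finset.range K, ∫ ω, D k ω ∂μ ≤ ((J : ℝ) + 1) * C := by
    rw [← integral_finsetSum _ fun k _ => hDint k]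
    calc ∫ ω, ∑ k ∈ Finset.range K, D k ω ∂μ ≤ ∫ _, ((J : ℝ) + 1) * C ∂μ := by
          refine integral_mono_ae (integrable_finsetSum _ fun k _ => hDint k) (integrable_const _) ?_
          filter_upwards [hchange] with ω hω
          simpa only [hD, hτ, Finset.sum_boole] using hω
      _ = _ := by simp
  have htel := Finset.sum_range_sub' (fun k => ∫ ω, (f (x k ω) + r (x k ω)) ∂μ) K
  have hfirst : ∫ ω, (f (x 0 ω) + r (x 0 ω)) ∂μ = f x₀ + r x₀ := by
    simp only [hx₀det, integral_const, probReal_univ, one_smul]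
  have hlast : φinf ≤ ∫ ω, (f (x K ω) + r (x K ω)) ∂μ := by
    calc φinf = ∫ _, φinf ∂μ := by simp
      _ ≤ _ := by
        refine integral_mono_ae (integrable_const _) (hφint K le_rfl) ?_
        filter_upwards [hxS K] with ω h using hφinf _ h
  have hsum := Finset.sum_le_sum fun k hk => hstep k (Finset.mem_range.1 hk)
  rw [← Finset.mul_sum, Finset.sum_add_distrib, Finset.sum_add_distrib, ← Finset.mul_sum,
    ← Finset.mul_sum, htel, hfirst] at hsum
  have hD' := mul_le_mul_of_nonneg_left hDsum
    (show 0 ≤ 3 * L * (s - c) ^ 2 * (Lr + 3 * Bg) ^ 2 by positivity)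
  have hK0 : (0 : ℝ) < K := by exact_mod_cast hK
  have hrhs : 2 * (f x₀ + r x₀ - φinf) / (α * c * K)
        + ((1 / L + 6 * L * s ^ 2 + 2 * α * c) / (α * c * K))
          * ∑ k ∈ Finset.range K, σ ^ 2 / N k
        + 6 * L * (s - c) ^ 2 * (Lr + 3 * Bg) ^ 2 * ((J : ℝ) + 1) * C / (α * c * K)
      = 2 / (α * c * K) * (f x₀ + r x₀ - φinf
        + (1 / (2 * L) + 3 * L * s ^ 2 + α * c) * ∑ k ∈ Finset.range K, σ ^ 2 / N k
        + 3 * L * (s - c) ^ 2 * (Lr + 3 * Bg) ^ 2 * (((J : ℝ) + 1) * C)) := by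
    field_simp
    ring
  rw [hrhs]
  calc _ = 2 / (α * c * K) * (α * c / 2 * ∑ k ∈ Finset.range K,
        ∫ ω, ‖(1 / s) • (x k ω - prox s (x k ω - s • g (x k ω)))‖ ^ 2 ∂μ) := by
        field_simp
    _ ≤ _ := by
        gcongr
        linarith
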